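/- arXiv:2403.01907 — 4 statements merged into one kernel-verified Lean document; each statement's English description precedes it below -/
import Mathlib

section
/- Let n be a positive integer, h ∈ ℝⁿ, and let k be a natural number with 0 ≤ k ≤ n. Then the minimum, over all subsets S of {1,…,n} of cardinality k, of Σ_{i∈S} h_i equals sup over ν ∈ ℝ of ( k·ν + Σ_{i=1}^n min(h_i - ν, 0) ); moreover this supremum is attained. -/
lemma aux_sum {n : ℕ} (h : Fin n → ℝ) (S : Finset (Fin n)) (k : ℕ) (hS : S.card = k) (ν : ℝ) :
    ∑ i ∈ S, h i = k * ν + ∑ i, (if i ∈ S then h i - ν else 0) := by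
  rw [Finset.sum_ite_mem, Finset.univ_inter, Finset.sum_sub_distrib, Finset.sum_const, hS,
    nsmul_eq_mul]
  ring

/-- strong Lagrangian duality for the perceptron dual term.
For `h ∈ ℝⁿ` and `0 ≤ k ≤ n`, the minimum over all subsets `S ⊆ {1,…,n}` of
cardinality `k` of `∑_{i∈S} hᵢ` equals `sup_{ν ∈ ℝ} ( k·ν + ∑ᵢ min(hᵢ - ν, 0) )`,
and this supremum is attained. -/
theorem min_subset_sum_lagrangian_duality (n : ℕ) (hn : 0 < n) (h : Fin n → ℝ)
    (k : ℕ) (hk : k ≤ n) :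
    IsGreatest {v : ℝ | ∃ ν : ℝ, v = k * ν + ∑ i, min (h i - ν) 0}
      ((Finset.univ.powersetCard k).inf'
        (Finset.powersetCard_nonempty_of_le (by simpa using hk))
        (fun S => ∑ i ∈ S, h i)) := by
  obtain ⟨S, hS, hSe⟩ := Finset.exists_mem_eq_inf' (s := Finset.univ.powersetCard k)
    (Finset.powersetCard_nonempty_of_le (by simpa using hk)) (fun S => ∑ i ∈ S, h i)
  have hmin : ∀ T : Finset (Fin n), T.card = k → ∑ i ∈ S, h i ≤ ∑ i ∈ T, h i := by
    intro T hT
    rw [← hSe]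
    exact Finset.inf'_le (fun S => ∑ i ∈ S, h i) (by simp [Finset.mem_powersetCard, hT])
  have hSk : S.card = k := (Finset.mem_powersetCard.1 hS).2
  rw [hSe]
  have hex : ∀ i ∈ S, ∀ j, j ∉ S → h i ≤ h j := by
    intro i hi j hj
    have hj' : j ∉ S.erase i := fun hh => hj (Finset.mem_of_mem_erase hh)
    have h1 := hmin (insert j (S.erase i)) (by
      rw [Finset.card_insert_of_notMem hj', Finset.card_erase_add_one hi, hSk])
    rw [Finset.sum_insert hj', ← Finset.add_sum_erase S h hi] at h1
    linarith
  constructor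
  · have hν : ∃ ν : ℝ, (∀ i ∈ S, h i ≤ ν) ∧ ∀ j, j ∉ S → ν ≤ h j := by
      by_cases hne : S.Nonempty
      · refine ⟨S.sup' hne h, fun i hi => Finset.le_sup' h hi, fun j hj => ?_⟩
        exact Finset.sup'_le hne h (fun i hi => hex i hi j hj)
      · rw [Finset.not_nonempty_iff_eq_empty] at hne
        have hu : (Finset.univ : Finset (Fin n)).Nonempty := ⟨⟨0, hn⟩, Finset.mem_univ _⟩
        exact ⟨Finset.univ.inf' hu h, by simp [hne],
          fun j _ => Finset.inf'_le h (Finset.mem_univ j)⟩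
    obtain ⟨ν, h1, h2⟩ := hν
    refine ⟨ν, ?_⟩
    show ∑ i ∈ S, h i = _
    rw [aux_sum h S k hSk ν]
    congr 1
    refine Finset.sum_congr rfl fun i _ => ?_
    split_ifs with hi
    · rw [min_eq_left (by linarith [h1 i hi])]
    · rw [min_eq_right (by linarith [h2 i hi])]
  · rintro v ⟨ν, rfl⟩
    show _ ≤ ∑ i ∈ S, h i
    rw [aux_sum h S k hSk ν]
    gcongr with i
    split_ifs
    · exact min_le_left _ _
    · exact min_le_right _ _
end

section
/- Let s ≥ 0 and let X : (0, 1/2) → ℝ satisfy X(δ) > 0 and erf(X(δ)) = 1 - 2δ for every δ ∈ (0, 1/2). Define ξ₁(δ) = -(1 - 2δ)² - ( √(2/π) e^{-X(δ)²} + s )². Then ξ₁ is twice differentiable on (0, 1/2) with ξ₁'(δ) = 4(1 - 2δ) - 4√2 · X(δ) · ( √(2/π) e^{-X(δ)²} + s ) and ξ₁''(δ) = -16 X(δ)² + 4√(2π) · s · e^{X(δ)²}. -/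
open Real

/-- The Gauss error function `erf(x) = (2/√π) ∫₀ˣ e^{-t²} dt`. -/
noncomputable def erf (x : ℝ) : ℝ :=
  (2 / Real.sqrt Real.pi) * ∫ t in (0 : ℝ)..x, Real.exp (-t ^ 2)

theorem erf_hasStrictDerivAt (x : ℝ) :
    HasStrictDerivAt erf ((2 / Real.sqrt Real.pi) * Real.exp (-x ^ 2)) x := by
  have hc : Continuous (fun t : ℝ => Real.exp (-t ^ 2)) := by fun_prop
  have h := intervalIntegral.integral_hasStrictDerivAt_right (hc.intervalIntegrable 0 x)
    (hc.stronglyMeasurableAtFilter _ _) hc.continuousAt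
  exact h.const_mul _

theorem erf_injective : Function.Injective erf := by
  apply StrictMono.injective
  apply strictMono_of_deriv_pos
  intro x
  rw [(erf_hasStrictDerivAt x).hasDerivAt.deriv]
  positivity

theorem X_hasDerivAt (X : ℝ → ℝ)
    (hX : ∀ δ ∈ Set.Ioo (0 : ℝ) (1 / 2), 0 < X δ ∧ erf (X δ) = 1 - 2 * δ)
    (δ : ℝ) (hδ : δ ∈ Set.Ioo (0 : ℝ) (1 / 2)) :
    HasDerivAt X (-Real.sqrt Real.pi * Real.exp ((X δ) ^ 2)) δ := by
  have hp : 0 < Real.sqrt Real.pi := Real.sqrt_pos.2 Real.pi_pos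
  have hE := Real.exp_pos (-(X δ) ^ 2)
  have h0 : (2 / Real.sqrt Real.pi) * Real.exp (-(X δ) ^ 2) ≠ 0 := by positivity
  have h := erf_hasStrictDerivAt (X δ)
  have hinv := (h.to_localInverse h0).hasDerivAt
  have hr := (h.hasStrictFDerivAt_equiv h0).eventually_right_inverse
  rw [(hX δ hδ).2] at hinv hr
  have hlin : HasDerivAt (fun y : ℝ => 1 - 2 * y) (-2) δ := by
    simpa using ((hasDerivAt_id δ).const_mul 2).const_sub 1
  have hcomp := HasDerivAt.comp δ hinv hlin
  have hr2 := hlin.continuousAt.eventually hr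
  have key := hcomp.congr_of_eventuallyEq (f₁ := X) (by
    filter_upwards [hr2, isOpen_Ioo.mem_nhds hδ] with y hy hy'
    apply erf_injective
    rw [(hX y hy').2]
    exact hy.symm)
  refine key.congr_deriv ?_
  rw [Real.exp_neg]
  field_simp

/-- Let `s ≥ 0` and let `X` satisfy `X(δ) > 0` and `erf(X(δ)) = 1 - 2δ`
on `(0, 1/2)` (i.e. `X(δ) = erfinv(1-2δ)`). Then
`ξ₁(δ) = -(1-2δ)² - ( √(2/π) e^{-X(δ)²} + s )²` is twice differentiable on `(0,1/2)` with
`ξ₁'(δ) = 4(1-2δ) - 4√2·X(δ)·( √(2/π) e^{-X(δ)²} + s )` and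
`ξ₁''(δ) = -16 X(δ)² + 4√(2π)·s·e^{X(δ)²}`. -/
theorem first_level_energy_derivs (s : ℝ) (hs : 0 ≤ s) (X ξ₁ : ℝ → ℝ)
    (hX : ∀ δ ∈ Set.Ioo (0 : ℝ) (1 / 2), 0 < X δ ∧ erf (X δ) = 1 - 2 * δ)
    (hξ : ∀ δ ∈ Set.Ioo (0 : ℝ) (1 / 2), ξ₁ δ =
      -(1 - 2 * δ) ^ 2 - (Real.sqrt (2 / Real.pi) * Real.exp (-(X δ) ^ 2) + s) ^ 2) :
    ∀ δ ∈ Set.Ioo (0 : ℝ) (1 / 2),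
      HasDerivAt ξ₁
        (4 * (1 - 2 * δ) - 4 * Real.sqrt 2 * X δ *
          (Real.sqrt (2 / Real.pi) * Real.exp (-(X δ) ^ 2) + s)) δ ∧
      HasDerivAt (deriv ξ₁)
        (-16 * (X δ) ^ 2 + 4 * Real.sqrt (2 * Real.pi) * s * Real.exp ((X δ) ^ 2)) δ := by
  have hp : 0 < Real.sqrt Real.pi := Real.sqrt_pos.2 Real.pi_pos
  have hp2 : Real.sqrt Real.pi ^ 2 = Real.pi := Real.sq_sqrt Real.pi_pos.le
  have h2 : Real.sqrt 2 ^ 2 = 2 := Real.sq_sqrt (by norm_num)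
  have hA : ∀ δ ∈ Set.Ioo (0 : ℝ) (1 / 2), HasDerivAt
      (fun y => Real.sqrt (2 / Real.pi) * Real.exp (-(X y) ^ 2) + s)
      (2 * Real.sqrt 2 * X δ) δ := by
    intro δ hδ
    have h := ((((X_hasDerivAt X hX δ hδ).pow 2).neg.exp).const_mul
      (Real.sqrt (2 / Real.pi))).add_const s
    refine h.congr_deriv ?_
    simp only [Pi.neg_apply, Pi.pow_apply]
    rw [Real.exp_neg, Real.sqrt_div (by norm_num)]
    field_simp
    norm_num [mul_comm]
  have hL : ∀ δ : ℝ, HasDerivAt (fun y : ℝ => 1 - 2 * y) (-2) δ := fun δ => by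
    simpa using ((hasDerivAt_id δ).const_mul 2).const_sub 1
  have h1 : ∀ δ ∈ Set.Ioo (0 : ℝ) (1 / 2), HasDerivAt ξ₁
        (4 * (1 - 2 * δ) - 4 * Real.sqrt 2 * X δ *
          (Real.sqrt (2 / Real.pi) * Real.exp (-(X δ) ^ 2) + s)) δ := by
    intro δ hδ
    have h := ((hL δ).pow 2).neg.sub ((hA δ hδ).pow 2)
    refine (h.congr_deriv ?_).congr_of_eventuallyEq ?_
    · simp only [Nat.cast_ofNat]
      ring
    · filter_upwards [isOpen_Ioo.mem_nhds hδ] with y hy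
      exact hξ y hy
  intro δ hδ
  refine ⟨h1 δ hδ, ?_⟩
  have h := ((hL δ).const_mul 4).sub
    (((X_hasDerivAt X hX δ hδ).const_mul (4 * Real.sqrt 2)).mul (hA δ hδ))
  refine (h.congr_deriv ?_).congr_of_eventuallyEq ?_
  · rw [Real.exp_neg, Real.sqrt_div (by norm_num), Real.sqrt_mul (by norm_num)]
    field_simp
    ring_nf
    rw [h2]
    ring
  · filter_upwards [isOpen_Ioo.mem_nhds hδ] with y hy
    exact (h1 y hy).deriv
end

section
/- Let α > 0, γ > 0, p ∈ (0,1), q ∈ (0,1), and c ∈ ℝ satisfy D := 2γ - c(1-p) > 0, together with the two stationarity equations q = α p / D² and 1 = α(1-p)/(2γD) + α p / D². Then the following closed-form relations hold: D = √(p α / q), γ = ( (1-p) / (2(1-q)) ) · √(q α / p), and c = √(q α / p)/(1-q) - √(p α / q)/(1-p). -/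
open Real

/-- Closed-form relations among the second-level lifting parameters:
if `α > 0`, `γ > 0`, `p, q ∈ (0,1)`, `D := 2γ - c(1-p) > 0`, and the stationarity
equations `q = α p / D²` and `1 = α(1-p)/(2γD) + α p / D²` hold, then
`D = √(pα/q)`, `γ = ((1-p)/(2(1-q)))·√(qα/p)`, and
`c = √(qα/p)/(1-q) - √(pα/q)/(1-p)`. -/
theorem second_level_closed_form_relations (α γ p q c : ℝ)
    (hα : 0 < α) (hγ : 0 < γ)
    (hp : p ∈ Set.Ioo (0 : ℝ) 1) (hq : q ∈ Set.Ioo (0 : ℝ) 1)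
    (hD : 0 < 2 * γ - c * (1 - p))
    (h1 : q = α * p / (2 * γ - c * (1 - p)) ^ 2)
    (h2 : 1 = α * (1 - p) / (2 * γ * (2 * γ - c * (1 - p))) +
      α * p / (2 * γ - c * (1 - p)) ^ 2) :
    2 * γ - c * (1 - p) = Real.sqrt (p * α / q) ∧
    γ = ((1 - p) / (2 * (1 - q))) * Real.sqrt (q * α / p) ∧
    c = Real.sqrt (q * α / p) / (1 - q) - Real.sqrt (p * α / q) / (1 - p) := by
  obtain ⟨hp0, hp1⟩ := hp
  obtain ⟨hq0, hq1⟩ := hq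
  rw [← h1] at h2
  obtain ⟨D, hDdef⟩ : ∃ D, D = 2 * γ - c * (1 - p) := ⟨_, rfl⟩
  rw [← hDdef] at hD h1 h2 ⊢
  have hp' : 0 < 1 - p := by linarith
  have hq' : 0 < 1 - q := by linarith
  have e1 : q * D ^ 2 = α * p := by
    rw [h1]; field_simp
  have e2 : (1 - q) * (2 * γ * D) = α * (1 - p) := by
    have h3 : 1 - q = α * (1 - p) / (2 * γ * D) := by linarith
    rw [h3]; field_simp
  have s1 : Real.sqrt (p * α / q) = D := by
    have : p * α / q = D ^ 2 := by
      rw [div_eq_iff hq0.ne']; linarith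
    rw [this, Real.sqrt_sq hD.le]
  have s2 : Real.sqrt (q * α / p) = α / D := by
    have : q * α / p = (α / D) ^ 2 := by
      rw [div_pow, div_eq_div_iff hp0.ne' (by positivity)]
      linear_combination α * e1
    rw [this, Real.sqrt_sq (by positivity)]
  have g : γ = ((1 - p) / (2 * (1 - q))) * (α / D) := by
    rw [div_mul_div_comm, eq_div_iff (by positivity)]
    linear_combination e2
  refine ⟨s1.symm, by rw [s2]; exact g, ?_⟩
  rw [s1, s2]
  have hc : c = 2 * γ / (1 - p) - D / (1 - p) := by
    rw [← sub_div, eq_div_iff hp'.ne']; linarith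
  have g2 : 2 * γ / (1 - p) = α / D / (1 - q) := by
    rw [div_div, div_eq_div_iff hp'.ne' (by positivity)]
    linear_combination e2
  rw [← g2]; exact hc
end

section
/- Let δ ∈ (0, 1/2), x > 0 with erf(x) = 1 - 2δ, and set B = √(2/π) e^{-x²} and C = √(2/π). Suppose s ≥ 0 satisfies the stationarity condition s = (1 - 2δ)/(√2 x) - B and the value-matching condition (1 - 2δ)² + ( (1 - 2δ)/(√2 x) )² = (C + s)². Then s = (1 - 2δ) √( 1 + 1/(2x²) ) - C, and consequently x satisfies the implicit equation (1 - 2δ) ( √( 1 + 1/(2x²) ) - 1/(√2 x) ) = √(2/π) ( 1 - e^{-x²} ). -/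
open Real

/-- Let `δ ∈ (0,1/2)`, `x > 0` with `erf(x) = 1-2δ`,
`B = √(2/π) e^{-x²}`, `C = √(2/π)`, and suppose `s ≥ 0` satisfies the stationarity
condition `s = (1-2δ)/(√2 x) - B` and the value-matching condition
`(1-2δ)² + ((1-2δ)/(√2 x))² = (C+s)²`. Then `s = (1-2δ)√(1 + 1/(2x²)) - C`, and
consequently `(1-2δ)( √(1 + 1/(2x²)) - 1/(√2 x) ) = √(2/π)( 1 - e^{-x²} )`. -/
theorem first_level_GLM_threshold (δ x s : ℝ) (hδ : δ ∈ Set.Ioo (0 : ℝ) (1 / 2))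
    (hx : 0 < x) (hex : erf x = 1 - 2 * δ) (B C : ℝ)
    (hB : B = Real.sqrt (2 / Real.pi) * Real.exp (-x ^ 2))
    (hC : C = Real.sqrt (2 / Real.pi)) (hs : 0 ≤ s)
    (hstat : s = (1 - 2 * δ) / (Real.sqrt 2 * x) - B)
    (hmatch : (1 - 2 * δ) ^ 2 + ((1 - 2 * δ) / (Real.sqrt 2 * x)) ^ 2 = (C + s) ^ 2) :
    s = (1 - 2 * δ) * Real.sqrt (1 + 1 / (2 * x ^ 2)) - C ∧
    (1 - 2 * δ) * (Real.sqrt (1 + 1 / (2 * x ^ 2)) - 1 / (Real.sqrt 2 * x)) =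
      Real.sqrt (2 / Real.pi) * (1 - Real.exp (-x ^ 2)) := by
  have hd : 0 < 1 - 2 * δ := by
    have := hδ.2
    linarith
  have hC0 : 0 ≤ C := by rw [hC]; exact Real.sqrt_nonneg _
  have h2 : Real.sqrt 2 ^ 2 = 2 := Real.sq_sqrt (by norm_num)
  have hR : Real.sqrt (1 + 1 / (2 * x ^ 2)) ^ 2 = 1 + 1 / (2 * x ^ 2) :=
    Real.sq_sqrt (by positivity)
  have hsq : (C + s) ^ 2 = ((1 - 2 * δ) * Real.sqrt (1 + 1 / (2 * x ^ 2))) ^ 2 := by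
    rw [← hmatch, mul_pow, hR, div_pow, mul_pow, h2]
    ring
  have key : C + s = (1 - 2 * δ) * Real.sqrt (1 + 1 / (2 * x ^ 2)) :=
    (pow_left_inj₀ (by positivity) (by positivity) two_ne_zero).1 hsq
  refine ⟨by linarith, ?_⟩
  rw [mul_sub, ← key, mul_one_div, mul_sub, mul_one, ← hB, ← hC]
  linarith
end
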